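/- Let X and Y be finite types and let F be a finite group with a homomorphism ρ : F → Perm (X ⊕ Y) such that every ρ(f) maps Sum.inl-elements to Sum.inl-elements and Sum.inr-elements to Sum.inr-elements. Let F act on R = MvPolynomial (X ⊕ Y) ℚ by permuting the variables via ρ, let A = {p ∈ R | ∀ f ∈ F, f • p = p} be the invariant subalgebra, let J be the ideal of R generated by the squares (X_{Sum.inr y})² of the Y-variables, and let Q be the image of A in the quotient ring R / J. Let S be the ℚ-subalgebra of Q generated by the images of the elementary symmetric polynomials e_1, …, e_{|X|} in the variables {X_{Sum.inl x} : x ∈ X} (these polynomials are F-invariant, hence lie in A). Then Q is a free S-module and is finitely generated as an S-module. -/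

import Mathlib

open MvPolynomial

/-- The subalgebra of polynomials invariant under a group `F` acting on
`MvPolynomial σ ℚ` by permuting the variables via `ρ : F →* Perm σ`. -/
noncomputable def invariantAlg {σ : Type*} (F : Type*) [Group F] (ρ : F →* Equiv.Perm σ) :
    Subalgebra ℚ (MvPolynomial σ ℚ) where
  carrier := {p | ∀ f : F, rename (ρ f) p = p}
  mul_mem' := by
    intro a b ha hb f
    rw [map_mul, ha f, hb f]
  one_mem' := fun f => map_one _
  add_mem' := by
    intro a b ha hb f
    rw [map_add, ha f, hb f]
  zero_mem' := fun f => map_zero _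
  algebraMap_mem' := by
    intro r f
    simp [MvPolynomial.algebraMap_eq]

/-- If `x` is a root of a monic polynomial `f` over `A` and of no nonzero polynomial of smaller
degree, then a module that is free over `A[x]` is free over `A`. -/
theorem Module.Free.of_adjoin_singleton {A B : Type*} [CommRing A] [Nontrivial A] [CommRing B]
    [Algebra A B]
    (x : B) (f : Polynomial A) (hf : f.Monic) (hfx : Polynomial.aeval x f = 0)
    (hmin : ∀ p : Polynomial A, p.degree < f.degree → Polynomial.aeval x p = 0 → p = 0)
    [Module.Free (Algebra.adjoin A {x}) B] : Module.Free A B := by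
  have hfree := hf.free_adjoinRoot
  let φ : AdjoinRoot f →ₐ[A] B := AdjoinRoot.liftAlgHom f (Algebra.ofId A B) x hfx
  have hφ : ∀ p, φ (AdjoinRoot.mk f p) = Polynomial.aeval x p := fun p => by
    simp [φ, Polynomial.aeval_def, Algebra.ofId]
  have hinj : Function.Injective φ := by
    rw [injective_iff_map_eq_zero]
    intro a ha
    obtain ⟨p, rfl⟩ := AdjoinRoot.mk_surjective a
    rw [hφ] at ha
    rw [AdjoinRoot.mk_eq_zero, ← Polynomial.modByMonic_eq_zero_iff_dvd hf]
    refine hmin _ (Polynomial.degree_modByMonic_lt p hf) ?_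
    rw [Polynomial.aeval_modByMonic_eq_self_of_root hfx, ha]
  have hrange : φ.range = Algebra.adjoin A {x} := by
    rw [Algebra.adjoin_singleton_eq_range_aeval]
    ext b
    constructor
    · rintro ⟨a, rfl⟩
      obtain ⟨p, rfl⟩ := AdjoinRoot.mk_surjective a
      exact ⟨p, (hφ p).symm⟩
    · rintro ⟨p, rfl⟩
      exact ⟨AdjoinRoot.mk f p, hφ p⟩
  have hadj : Module.Free A (Algebra.adjoin A {x}) :=
    Module.Free.of_equiv
      ((AlgEquiv.ofInjective φ hinj).trans (Subalgebra.equivOfEq _ _ hrange)).toLinearEquiv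
  exact Module.Free.trans (S := Algebra.adjoin A {x})

section

variable (X Y : Type*) [Fintype X]

/-- The elementary symmetric polynomials of positive degree in the left variables. -/
def leftEsymm : Set (MvPolynomial (X ⊕ Y) ℚ) :=
  {p | ∃ r : ℕ, 1 ≤ r ∧ r ≤ Fintype.card X ∧ p = rename Sum.inl (esymm X ℚ r)}

/-- The subalgebra of symmetric polynomials in the left variables. -/
noncomputable def leftSymm : Subalgebra ℚ (MvPolynomial (X ⊕ Y) ℚ) :=
  Algebra.adjoin ℚ (leftEsymm X Y)

/-- The subalgebra generated by the symmetric polynomials in the left variables together with the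
left variables indexed by `T`. -/
noncomputable def leftSymmAdjoin (T : Finset X) : Subalgebra ℚ (MvPolynomial (X ⊕ Y) ℚ) :=
  Algebra.adjoin ℚ (leftEsymm X Y ∪ (fun x => MvPolynomial.X (Sum.inl x)) '' (T : Set X))

variable {X Y}

theorem rename_inl_esymm_mem_leftSymm (r : ℕ) :
    rename Sum.inl (esymm X ℚ r) ∈ leftSymm X Y := by
  rcases Nat.eq_zero_or_pos r with rfl | hr
  · simp [esymm_zero, one_mem]
  · by_cases h : r ≤ Fintype.card X
    · exact Algebra.subset_adjoin ⟨r, hr, h, rfl⟩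
    · rw [esymm, Finset.powersetCard_eq_empty.mpr (by simpa using h)]
      simp

theorem rename_eq_of_mem_leftEsymm (e : Equiv.Perm (X ⊕ Y))
    (he : ∀ x : X, ∃ x', e (Sum.inl x) = Sum.inl x') {p : MvPolynomial (X ⊕ Y) ℚ}
    (hp : p ∈ leftEsymm X Y) : rename e p = p := by
  obtain ⟨r, -, -, rfl⟩ := hp
  choose σ hσ using he
  have hinj : Function.Injective σ := fun a b h => by
    have := (hσ a).trans ((congrArg Sum.inl h).trans (hσ b).symm)
    simpa using this
  let τ : Equiv.Perm X := Equiv.ofBijective σ (Finite.injective_iff_bijective.mp hinj)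
  have hcomp : (e : X ⊕ Y → X ⊕ Y) ∘ Sum.inl = Sum.inl ∘ τ := funext hσ
  rw [rename_rename, hcomp, ← rename_rename, rename_esymm]

theorem rename_eq_of_mem_leftSymmAdjoin {T : Finset X} (e : Equiv.Perm (X ⊕ Y))
    (he : ∀ x : X, ∃ x', e (Sum.inl x) = Sum.inl x')
    (hT : ∀ x ∈ T, e (Sum.inl x) = Sum.inl x)
    {p : MvPolynomial (X ⊕ Y) ℚ} (hp : p ∈ leftSymmAdjoin X Y T) : rename e p = p := by
  have hle : leftSymmAdjoin X Y T ≤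
      AlgHom.equalizer (rename e) (AlgHom.id ℚ (MvPolynomial (X ⊕ Y) ℚ)) := by
    refine Algebra.adjoin_le ?_
    rintro q (hq | ⟨x, hx, rfl⟩)
    · exact rename_eq_of_mem_leftEsymm e he hq
    · simp [hT x hx]
  exact hle hp

theorem leftSymmAdjoin_empty : leftSymmAdjoin X Y ∅ = leftSymm X Y := by
  simp [leftSymmAdjoin, leftSymm]

theorem leftSymmAdjoin_mono {T U : Finset X} (h : T ⊆ U) :
    leftSymmAdjoin X Y T ≤ leftSymmAdjoin X Y U :=
  Algebra.adjoin_mono (Set.union_subset_union_right _ (Set.image_mono (by simpa using h)))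

theorem X_mem_leftSymmAdjoin {T : Finset X} {x : X} (hx : x ∈ T) :
    (MvPolynomial.X (Sum.inl x) : MvPolynomial (X ⊕ Y) ℚ) ∈ leftSymmAdjoin X Y T :=
  Algebra.subset_adjoin (Or.inr ⟨x, hx, rfl⟩)

theorem leftSymmAdjoin_univ :
    leftSymmAdjoin X Y Finset.univ =
      (rename Sum.inl : MvPolynomial X ℚ →ₐ[ℚ] MvPolynomial (X ⊕ Y) ℚ).range := by
  apply le_antisymm
  · refine Algebra.adjoin_le ?_
    rintro q (⟨r, -, -, rfl⟩ | ⟨x, -, rfl⟩)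
    · exact ⟨_, rfl⟩
    · exact ⟨MvPolynomial.X x, by simp⟩
  · rw [← Algebra.map_top, ← MvPolynomial.adjoin_range_X, AlgHom.map_adjoin]
    refine Algebra.adjoin_le ?_
    rintro _ ⟨_, ⟨x, rfl⟩, rfl⟩
    simpa using X_mem_leftSymmAdjoin (Finset.mem_univ x)

theorem leftSymmAdjoin_insert [DecidableEq X] (T : Finset X) (x : X) :
    leftSymmAdjoin X Y (insert x T) =
      (Algebra.adjoin (leftSymmAdjoin X Y T)
        {(MvPolynomial.X (Sum.inl x) : MvPolynomial (X ⊕ Y) ℚ)}).restrictScalars ℚ := by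
  rw [leftSymmAdjoin, leftSymmAdjoin, ← Algebra.adjoin_union_eq_adjoin_adjoin, Finset.coe_insert,
    Set.image_insert_eq, Set.union_assoc, Set.insert_eq, Set.union_comm {_}]

theorem prod_X_sub_C_mem_lifts [DecidableEq X] (T : Finset X) :
    (∏ x ∈ Tᶜ, (Polynomial.X - Polynomial.C (MvPolynomial.X (Sum.inl x)))) ∈
      Polynomial.lifts (algebraMap (leftSymmAdjoin X Y T) (MvPolynomial (X ⊕ Y) ℚ)) := by
  induction T using Finset.induction_on with
  | empty =>
    let s : Multiset (MvPolynomial (X ⊕ Y) ℚ) :=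
      Finset.univ.val.map fun x : X => MvPolynomial.X (Sum.inl x)
    have h : ∏ x : X, (Polynomial.X -
        Polynomial.C (MvPolynomial.X (Sum.inl x) : MvPolynomial (X ⊕ Y) ℚ)) =
        ∑ j ∈ Finset.range (Multiset.card s + 1),
          (-1) ^ j * (Polynomial.C (s.esymm j) * Polynomial.X ^ (Multiset.card s - j)) := by
      rw [← Multiset.prod_X_sub_X_eq_sum_esymm, Multiset.map_map]
      rfl
    rw [Finset.compl_empty, h, Polynomial.lifts_iff_liftsRing]
    refine sum_mem fun j _ => mul_mem (pow_mem (neg_mem (one_mem _)) _)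
      (mul_mem ?_ (pow_mem ?_ _))
    · have hrename : (rename Sum.inl : MvPolynomial X ℚ →ₐ[ℚ] MvPolynomial (X ⊕ Y) ℚ) =
          aeval fun x => MvPolynomial.X (Sum.inl x) := by
        ext x
        simp
      have hj : s.esymm j = rename Sum.inl (esymm X ℚ j) := by
        rw [hrename, aeval_esymm_eq_multiset_esymm]
      rw [← Polynomial.lifts_iff_liftsRing, hj]
      refine Polynomial.C'_mem_lifts ⟨⟨_, ?_⟩, rfl⟩
      rw [leftSymmAdjoin_empty]
      exact rename_inl_esymm_mem_leftSymm j
    · rw [← Polynomial.lifts_iff_liftsRing]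
      exact Polynomial.X_mem_lifts _
  | insert i T hi ih =>
    obtain ⟨q, hq⟩ := (Polynomial.mem_lifts _).mp ih
    let ι := Subalgebra.inclusion (leftSymmAdjoin_mono (Y := Y) (Finset.subset_insert i T))
    let ξ : leftSymmAdjoin X Y (insert i T) :=
      ⟨MvPolynomial.X (Sum.inl i), X_mem_leftSymmAdjoin (Finset.mem_insert_self i T)⟩
    refine (Polynomial.mem_lifts _).mpr
      ⟨q.map (ι : _ →+* _) /ₘ (Polynomial.X - Polynomial.C ξ), ?_⟩
    have hins : Tᶜ = insert i (insert i T)ᶜ := by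
      ext j
      by_cases hj : j = i <;> simp [hj, hi]
    rw [Polynomial.map_divByMonic _ (Polynomial.monic_X_sub_C ξ), Polynomial.map_map]
    have hcomp : (algebraMap (leftSymmAdjoin X Y (insert i T)) (MvPolynomial (X ⊕ Y) ℚ)).comp
        (ι : _ →+* _) = algebraMap (leftSymmAdjoin X Y T) (MvPolynomial (X ⊕ Y) ℚ) := rfl
    rw [hcomp, hq, hins, Finset.prod_insert (by simp), Polynomial.map_sub, Polynomial.map_X,
      Polynomial.map_C]
    exact Polynomial.mul_divByMonic_cancel_left _ (Polynomial.monic_X_sub_C _)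

theorem free_leftSymmAdjoin_of_insert [DecidableEq X] {T : Finset X} {i : X} (hi : i ∉ T)
    (h : Module.Free (leftSymmAdjoin X Y (insert i T)) (MvPolynomial (X ⊕ Y) ℚ)) :
    Module.Free (leftSymmAdjoin X Y T) (MvPolynomial (X ⊕ Y) ℚ) := by
  classical
  rw [leftSymmAdjoin_insert] at h
  have h' : Module.Free (Algebra.adjoin (leftSymmAdjoin X Y T)
    {(MvPolynomial.X (Sum.inl i) : MvPolynomial (X ⊕ Y) ℚ)}) (MvPolynomial (X ⊕ Y) ℚ) := h
  have hmonic : (∏ x ∈ Tᶜ, (Polynomial.X -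
      Polynomial.C (MvPolynomial.X (Sum.inl x) : MvPolynomial (X ⊕ Y) ℚ))).Monic :=
    Polynomial.monic_prod_of_monic _ _ fun x _ => Polynomial.monic_X_sub_C _
  obtain ⟨f, hf, hdeg, hfm⟩ :=
    Polynomial.lifts_and_degree_eq_and_monic (prod_X_sub_C_mem_lifts (Y := Y) T) hmonic
  refine Module.Free.of_adjoin_singleton (MvPolynomial.X (Sum.inl i)) f hfm ?_ ?_
  · rw [Polynomial.aeval_def, ← Polynomial.eval_map, hf, Polynomial.eval_prod]
    exact Finset.prod_eq_zero (Finset.mem_compl.mpr hi) (by simp)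
  · intro p hp hpi
    have hinj : Function.Injective
        (fun x : X => (MvPolynomial.X (Sum.inl x) : MvPolynomial (X ⊕ Y) ℚ)) :=
      (MvPolynomial.X_injective).comp Sum.inl_injective
    have hmap : Function.Injective
        (algebraMap (leftSymmAdjoin X Y T) (MvPolynomial (X ⊕ Y) ℚ)) := Subtype.val_injective
    rw [← Polynomial.map_eq_zero_iff hmap]
    by_contra hne
    refine hne (Polynomial.eq_zero_of_natDegree_lt_card_of_eval_eq_zero' _
      (Tᶜ.image fun x => MvPolynomial.X (Sum.inl x)) ?_ ?_)
    · intro z hz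
      obtain ⟨j, hj, rfl⟩ := Finset.mem_image.mp hz
      have hjT := Finset.mem_compl.mp hj
      let e : Equiv.Perm (X ⊕ Y) := Equiv.sumCongr (Equiv.swap i j) (Equiv.refl Y)
      have hfix : ((rename e : MvPolynomial (X ⊕ Y) ℚ →ₐ[ℚ] _) : _ →+* _).comp
          (algebraMap (leftSymmAdjoin X Y T) (MvPolynomial (X ⊕ Y) ℚ)) =
          algebraMap (leftSymmAdjoin X Y T) (MvPolynomial (X ⊕ Y) ℚ) := by
        refine RingHom.ext fun a => rename_eq_of_mem_leftSymmAdjoin e (fun x => ⟨_, rfl⟩) ?_ a.2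
        intro x hx
        have : Equiv.swap i j x = x := Equiv.swap_apply_of_ne_of_ne
          (fun h => hi (h ▸ hx)) (fun h => hjT (h ▸ hx))
        exact congrArg Sum.inl this
      have := congrArg (rename e) hpi
      rw [Polynomial.aeval_def, ← AlgHom.coe_toRingHom, Polynomial.hom_eval₂, map_zero] at this
      erw [hfix] at this
      rw [Polynomial.eval_map]
      simpa [e] using this
    · rw [Finset.card_image_of_injective _ hinj, Polynomial.natDegree_lt_iff_degree_lt hne]
      refine (Polynomial.degree_map_le).trans_lt (hp.trans_eq ?_)
      rw [hdeg, Polynomial.degree_prod]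
      simp

theorem free_leftSymmAdjoin_univ :
    Module.Free (leftSymmAdjoin X Y Finset.univ) (MvPolynomial (X ⊕ Y) ℚ) := by
  rw [leftSymmAdjoin_univ]
  let r := AlgEquiv.ofInjective (rename Sum.inl : MvPolynomial X ℚ →ₐ[ℚ] MvPolynomial (X ⊕ Y) ℚ)
    (rename_injective _ Sum.inl_injective)
  let e : MvPolynomial Y (MvPolynomial X ℚ) ≃ₐ[ℚ] MvPolynomial (X ⊕ Y) ℚ :=
    (sumAlgEquiv ℚ Y X).symm.trans (renameEquiv ℚ (Equiv.sumComm Y X))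
  have he : ∀ p : MvPolynomial X ℚ, e (C p) = rename Sum.inl p := by
    intro p
    have : e.toAlgHom.comp (IsScalarTower.toAlgHom ℚ (MvPolynomial X ℚ)
        (MvPolynomial Y (MvPolynomial X ℚ))) = rename Sum.inl := by
      ext x
      simp [e, MvPolynomial.algebraMap_eq]
    exact DFunLike.congr_fun this p
  let σ : MvPolynomial X ℚ ≃+* (rename Sum.inl :
    MvPolynomial X ℚ →ₐ[ℚ] MvPolynomial (X ⊕ Y) ℚ).range := r.toRingEquiv
  let _ := RingHomInvPair.of_ringEquiv σ
  let _ := (RingHomInvPair.of_ringEquiv σ).symm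
  let l : MvPolynomial Y (MvPolynomial X ℚ) ≃ₛₗ[(σ : MvPolynomial X ℚ →+*
      (rename Sum.inl : MvPolynomial X ℚ →ₐ[ℚ] MvPolynomial (X ⊕ Y) ℚ).range)]
      MvPolynomial (X ⊕ Y) ℚ :=
    { e with
      map_smul' := fun p q => by
        change e (p • q) = rename Sum.inl p * e q
        rw [MvPolynomial.smul_eq_C_mul, map_mul, he] }
  exact Module.Free.of_equiv l

/-- A polynomial ring is free over the symmetric polynomials in part of its variables. -/
theorem free_leftSymm : Module.Free (leftSymm X Y) (MvPolynomial (X ⊕ Y) ℚ) := by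
  classical
  rw [← leftSymmAdjoin_empty]
  suffices h : ∀ T : Finset X, Module.Free (leftSymmAdjoin X Y T) (MvPolynomial (X ⊕ Y) ℚ) →
      Module.Free (leftSymmAdjoin X Y ∅) (MvPolynomial (X ⊕ Y) ℚ) from
    h _ free_leftSymmAdjoin_univ
  intro T
  induction T using Finset.induction_on with
  | empty => exact id
  | insert i T hi ih => exact fun h => ih (free_leftSymmAdjoin_of_insert hi h)

end

/-- A generating family of a projective module over a domain, which is minimal modulo a proper
ideal, is linearly independent. -/
theorem linearIndependent_of_projective_of_quotient {S P ι : Type*} [CommRing S] [IsDomain S]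
    [AddCommGroup P] [Module S P] [Module.Projective S P] [Fintype ι] (I : Ideal S) (hI : I ≠ ⊤)
    (b : ι → P) (hspan : Submodule.span S (Set.range b) = ⊤)
    (hb : ∀ c : ι → S, ∑ i, c i • b i ∈ (I • ⊤ : Submodule S P) → ∀ i, c i ∈ I) :
    LinearIndependent S b := by
  classical
  let φ : (ι → S) →ₗ[S] P := Fintype.linearCombination S b
  have hφ : ∀ c, φ c = ∑ i, c i • b i := fun c => Fintype.linearCombination_apply S b c
  have hsurj : Function.Surjective φ := by
    rw [← LinearMap.range_eq_top, Fintype.range_linearCombination, hspan]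
  obtain ⟨s, hs⟩ := Module.projective_lifting_property φ LinearMap.id hsurj
  let π : (ι → S) →ₗ[S] (ι → S) := LinearMap.id - s.comp φ
  have hπker : ∀ x, π x ∈ LinearMap.ker φ := fun x => by
    have := LinearMap.congr_fun hs (φ x)
    simp only [LinearMap.comp_apply, LinearMap.id_apply] at this
    simp [π, this]
  have hπid : ∀ x ∈ LinearMap.ker φ, π x = x := fun x hx => by
    simp [π, LinearMap.mem_ker.mp hx]
  have hrange : LinearMap.range π = LinearMap.ker φ :=
    le_antisymm (by rintro _ ⟨x, rfl⟩; exact hπker x) fun x hx => ⟨x, hπid x hx⟩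
  have hfg : (LinearMap.ker φ).FG := by
    rw [← hrange, LinearMap.range_eq_map]
    exact Module.Finite.fg_top.map π
  have hle : LinearMap.ker φ ≤ I • LinearMap.ker φ := fun x hx => by
    have hxI : ∀ i, x i ∈ I := hb x (by
      rw [← hφ, LinearMap.mem_ker.mp hx]
      exact zero_mem _)
    rw [← hπid x hx, pi_eq_sum_univ' x, map_sum]
    refine sum_mem fun i _ => ?_
    rw [map_smul]
    exact Submodule.smul_mem_smul (hxI i) (hπker _)
  obtain ⟨r, hr, hr0⟩ :=
    Submodule.exists_sub_one_mem_and_smul_eq_zero_of_fg_of_le_smul I _ hfg hle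
  have hrne : r ≠ 0 := fun h => hI ((Ideal.eq_top_iff_one I).mpr (by simpa [h] using hr))
  rw [Fintype.linearIndependent_iff]
  intro c hc
  have := (smul_eq_zero.mp (hr0 c (by rw [LinearMap.mem_ker, hφ, hc]))).resolve_left hrne
  exact fun i => congrFun this i

theorem MvPolynomial.homogeneousComponent_mul {σ k : Type*} [CommSemiring k] (d : ℕ)
    (p q : MvPolynomial σ k) :
    homogeneousComponent d (p * q) = ∑ ij ∈ Finset.HasAntidiagonal.antidiagonal d,
      homogeneousComponent ij.1 p * homogeneousComponent ij.2 q := by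
  classical
  ext m
  simp only [coeff_sum, coeff_mul, coeff_homogeneousComponent]
  rw [Finset.sum_comm]
  have hdeg : ∀ ab ∈ Finset.HasAntidiagonal.antidiagonal m,
      (∑ ij ∈ Finset.HasAntidiagonal.antidiagonal d,
        (if ab.1.degree = ij.1 then coeff ab.1 p else 0) *
          (if ab.2.degree = ij.2 then coeff ab.2 q else 0)) =
      if m.degree = d then coeff ab.1 p * coeff ab.2 q else 0 := by
    intro ab hab
    rw [Finset.HasAntidiagonal.mem_antidiagonal] at hab
    have hm : m.degree = ab.1.degree + ab.2.degree := by rw [← hab, map_add]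
    split_ifs with h
    · rw [Finset.sum_eq_single (ab.1.degree, ab.2.degree)]
      · simp
      · rintro ⟨i, j⟩ - hne
        by_cases hi : ab.1.degree = i
        · by_cases hj : ab.2.degree = j
          · exact absurd (by rw [hi, hj]) hne
          · simp [hj]
        · simp [hi]
      · intro hn
        exact absurd (Finset.HasAntidiagonal.mem_antidiagonal.mpr (hm.symm.trans h)) hn
    · refine Finset.sum_eq_zero fun ij hij => ?_
      rw [Finset.HasAntidiagonal.mem_antidiagonal] at hij
      by_cases hi : ab.1.degree = ij.1
      · have hj : ab.2.degree ≠ ij.2 := by omega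
        simp [hj]
      · simp [hi]
  rw [Finset.sum_congr rfl hdeg]
  split_ifs <;> simp

/-- A set whose image spans a finite-dimensional space contains a finite family mapping to a
basis. -/
theorem exists_fin_linearIndependent_of_span_image {k V P : Type*} [Field k] [AddCommGroup V]
    [Module k V] [Module.Finite k V] (f : P → V) (H : Set P)
    (hH : Submodule.span k (f '' H) = ⊤) :
    ∃ (n : ℕ) (b : Fin n → P), (∀ i, b i ∈ H) ∧ LinearIndependent k (fun i => f (b i)) ∧
      Submodule.span k (Set.range fun i => f (b i)) = ⊤ := by
  obtain ⟨t, htH, htspan, htli⟩ := exists_linearIndependent k (f '' H)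
  have htfin : Finite t := htli.finite
  let ε := Finite.equivFin t
  choose b hbH hb using fun i => htH (ε.symm i).2
  refine ⟨_, b, hbH, ?_, ?_⟩
  · simp only [hb]
    exact htli.comp _ ε.symm.injective
  · rw [← hH, ← htspan]
    congr 1
    simp only [hb]
    exact (ε.symm.surjective.range_comp Subtype.val).trans Subtype.range_coe

section Graded

variable {k S P : Type*} [Field k] [CommRing S] [Algebra k S]
  [AddCommGroup P] [Module k P] [Module S P] [IsScalarTower k S P]

/-- Graded Nakayama lemma: homogeneous elements that generate modulo the augmentation ideal
generate. The gradings are given by the maps `gr` and `pr` onto the homogeneous components. -/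
theorem span_eq_top_of_graded {ι : Type*} [Fintype ι] (I : Ideal S) (gr : ℕ → S → S)
    (pr : ℕ → P →ₗ[k] P) (hgr : ∀ s ∈ I, gr 0 s = 0)
    (hmul : ∀ d s p, pr d (s • p) =
      ∑ ij ∈ Finset.HasAntidiagonal.antidiagonal d, gr ij.1 s • pr ij.2 p)
    (hsum : ∀ p, ∃ n, p = ∑ d ∈ Finset.range n, pr d p)
    (hpr : ∀ d e p, pr d (pr e p) = if e = d then pr e p else 0)
    (b : ι → P) (hb : ∀ i, ∃ d q, b i = pr d q)
    (hgen : ∀ p, ∃ c : ι → k, p - ∑ i, c i • b i ∈ (I • ⊤ : Submodule S P)) :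
    Submodule.span S (Set.range b) = ⊤ := by
  have key : ∀ d, ∀ p : P, pr d p ∈ Submodule.span S (Set.range b) := by
    intro d
    induction d using Nat.strong_induction_on with
    | _ d ih =>
    have hI : ∀ z ∈ (I • ⊤ : Submodule S P), pr d z ∈ Submodule.span S (Set.range b) := by
      intro z hz
      induction hz using Submodule.smul_induction_on' with
      | add x _ y _ hx hy => rw [map_add]; exact add_mem hx hy
      | smul s hs q _ =>
        rw [hmul]
        refine sum_mem fun ij hij => ?_
        rw [Finset.HasAntidiagonal.mem_antidiagonal] at hij
        rcases Nat.eq_zero_or_pos ij.1 with h0 | h0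
        · rw [h0, hgr s hs, zero_smul]
          exact zero_mem _
        · exact Submodule.smul_mem _ _ (ih _ (by omega) q)
    intro p
    obtain ⟨c, hc⟩ := hgen p
    have hz := hI _ hc
    rw [map_sub, map_sum] at hz
    rw [← sub_add_cancel (pr d p) (∑ i, pr d (c i • b i))]
    refine add_mem hz (sum_mem fun i _ => ?_)
    rw [map_smul, ← algebraMap_smul S (c i)]
    refine Submodule.smul_mem _ _ ?_
    obtain ⟨e, q, he⟩ := hb i
    rw [he, hpr, ← he]
    split_ifs
    · exact Submodule.subset_span ⟨i, rfl⟩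
    · exact zero_mem _
  rw [eq_top_iff]
  rintro p -
  obtain ⟨n, hn⟩ := hsum p
  rw [hn]
  exact sum_mem fun d _ => key d p

theorem smul_sub_aug_smul_mem (aug : S →ₐ[k] k) (s : S) (p : P) :
    s • p - aug s • p ∈ (RingHom.ker aug • ⊤ : Submodule S P) := by
  rw [← algebraMap_smul S (aug s) p, ← sub_smul]
  exact Submodule.smul_mem_smul (by simp [RingHom.mem_ker]) trivial

theorem mkQ_smul_eq_aug_smul (aug : S →ₐ[k] k) (s : S) (p : P) :
    (RingHom.ker aug • ⊤ : Submodule S P).mkQ (s • p) =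
      aug s • (RingHom.ker aug • ⊤ : Submodule S P).mkQ p :=
  (Submodule.Quotient.eq _).mpr (smul_sub_aug_smul_mem aug s p)

theorem finite_quotient_ker_aug_smul [Module.Finite S P] (aug : S →ₐ[k] k) :
    Module.Finite k (P ⧸ (RingHom.ker aug • ⊤ : Submodule S P)) := by
  classical
  obtain ⟨g, hg⟩ := (Module.Finite.fg_top : (⊤ : Submodule S P).FG)
  refine ⟨g.image (RingHom.ker aug • ⊤ : Submodule S P).mkQ, ?_⟩
  rw [eq_top_iff]
  rintro v -
  obtain ⟨p, rfl⟩ := Submodule.mkQ_surjective _ v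
  have hp : p ∈ Submodule.span S (g : Set P) := hg ▸ trivial
  induction hp using Submodule.span_induction with
  | mem x hx => exact Submodule.subset_span (by simpa using ⟨x, hx, rfl⟩)
  | zero => simp
  | add x y _ _ hx hy => rw [map_add]; exact add_mem hx hy
  | smul s x _ hx => rw [mkQ_smul_eq_aug_smul]; exact Submodule.smul_mem _ _ hx

/-- Over a graded connected domain `S`, a graded module which is finitely generated and projective
is free. The gradings are given by the maps `gr` and `pr` onto the homogeneous components. -/
theorem exists_basis_of_graded [IsDomain S] [Module.Finite S P] [Module.Projective S P]
    (aug : S →ₐ[k] k) (gr : ℕ → S → S) (pr : ℕ → P →ₗ[k] P)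
    (hgr : ∀ s, aug s = 0 → gr 0 s = 0)
    (hmul : ∀ d s p, pr d (s • p) =
      ∑ ij ∈ Finset.HasAntidiagonal.antidiagonal d, gr ij.1 s • pr ij.2 p)
    (hsum : ∀ p, ∃ n, p = ∑ d ∈ Finset.range n, pr d p)
    (hpr : ∀ d e p, pr d (pr e p) = if e = d then pr e p else 0) :
    ∃ (n : ℕ) (b : Fin n → P), LinearIndependent S b ∧
      Submodule.span S (Set.range b) = ⊤ := by
  have hfin := finite_quotient_ker_aug_smul (P := P) aug
  have hHspan : Submodule.span k ((RingHom.ker aug • ⊤ : Submodule S P).mkQ ''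
      {p | ∃ d q, p = pr d q}) = ⊤ := by
    rw [eq_top_iff]
    rintro v -
    obtain ⟨p, rfl⟩ := Submodule.mkQ_surjective _ v
    obtain ⟨n, hn⟩ := hsum p
    rw [hn, map_sum]
    exact sum_mem fun d _ => Submodule.subset_span ⟨_, ⟨d, p, rfl⟩, rfl⟩
  obtain ⟨n, b, hbH, hbli, hbspan⟩ := exists_fin_linearIndependent_of_span_image _ _ hHspan
  have hk : ∀ (c : k) (p : P), (RingHom.ker aug • ⊤ : Submodule S P).mkQ (c • p) =
      c • (RingHom.ker aug • ⊤ : Submodule S P).mkQ p := fun c p => rfl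
  have hspan : Submodule.span S (Set.range b) = ⊤ := by
    refine span_eq_top_of_graded (RingHom.ker aug) gr pr (fun s hs => hgr s hs) hmul hsum hpr b
      hbH fun p => ?_
    have hp : (RingHom.ker aug • ⊤ : Submodule S P).mkQ p ∈ Submodule.span k
        (Set.range fun i => (RingHom.ker aug • ⊤ : Submodule S P).mkQ (b i)) := hbspan ▸ trivial
    obtain ⟨c, hc⟩ := (Submodule.mem_span_range_iff_exists_fun k).mp hp
    refine ⟨c, (Submodule.Quotient.eq _).mp ?_⟩
    rw [← Submodule.mkQ_apply, ← Submodule.mkQ_apply, map_sum, ← hc]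
    simp only [hk]
  refine ⟨n, b, linearIndependent_of_projective_of_quotient (RingHom.ker aug)
    (RingHom.ker_ne_top _) b hspan ?_, hspan⟩
  intro c hc i
  rw [← Submodule.Quotient.mk_eq_zero, ← Submodule.mkQ_apply, map_sum] at hc
  simp only [mkQ_smul_eq_aug_smul] at hc
  exact Fintype.linearIndependent_iff.mp hbli _ hc i

end Graded

/-- A shortcut instance: the general search for this module structure is slow. -/
instance Subalgebra.moduleSubmodule {k A : Type*} [CommRing k] [CommRing A] [Algebra k A]
    (S : Subalgebra k A) (P : Submodule S A) : Module S P := P.module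

/-- A shortcut instance: the general search for this scalar action is slow. -/
instance Subalgebra.smulSubmodule {k A : Type*} [CommRing k] [CommRing A] [Algebra k A]
    (S : Subalgebra k A) (P : Submodule S A) : SMul S P := P.smul

theorem MvPolynomial.homogeneousComponent_homogeneousComponent {σ k : Type*} [CommSemiring k]
    (d e : ℕ) (p : MvPolynomial σ k) :
    homogeneousComponent d (homogeneousComponent e p) =
      if e = d then homogeneousComponent e p else 0 := by
  rw [homogeneousComponent_of_mem (homogeneousComponent_isHomogeneous e p)]
  simp only [eq_comm]

/-- A subalgebra generated by homogeneous polynomials contains the homogeneous components of its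
elements. -/
theorem MvPolynomial.homogeneousComponent_mem_adjoin {σ k : Type*} [CommSemiring k]
    {s : Set (MvPolynomial σ k)} (hs : ∀ p ∈ s, ∃ d, p.IsHomogeneous d)
    {p : MvPolynomial σ k} (hp : p ∈ Algebra.adjoin k s) (d : ℕ) :
    homogeneousComponent d p ∈ Algebra.adjoin k s := by
  induction hp using Algebra.adjoin_induction generalizing d with
  | mem p hp =>
    obtain ⟨e, he⟩ := hs p hp
    rw [homogeneousComponent_of_mem he]
    split_ifs
    · exact Algebra.subset_adjoin hp
    · exact zero_mem _
  | algebraMap c =>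
    rw [MvPolynomial.algebraMap_eq, homogeneousComponent_of_mem (isHomogeneous_C σ c)]
    split_ifs
    · exact Subalgebra.algebraMap_mem _ c
    · exact zero_mem _
  | add p q _ _ hp hq => rw [map_add]; exact add_mem (hp d) (hq d)
  | mul p q _ _ hp hq =>
    rw [homogeneousComponent_mul]
    exact sum_mem fun ij _ => mul_mem (hp _) (hq _)

/-- A graded submodule of a polynomial ring over a graded subalgebra `S`, which is finitely
generated and projective over `S`, is free. -/
theorem exists_basis_of_homogeneousComponent_mem {σ k : Type*} [Field k]
    (S : Subalgebra k (MvPolynomial σ k)) (P : Submodule S (MvPolynomial σ k))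
    (hS : ∀ s ∈ S, ∀ d, homogeneousComponent d s ∈ S)
    (hP : ∀ p ∈ P, ∀ d, homogeneousComponent d p ∈ P)
    [Module.Finite S P] [Module.Projective S P] :
    ∃ (n : ℕ) (b : Fin n → MvPolynomial σ k), LinearIndependent S b ∧
      Submodule.span S (Set.range b) = P := by
  let aug : S →ₐ[k] k := (aeval (0 : σ → k)).comp S.val
  have haug : ∀ s : S, aug s = coeff 0 (s : MvPolynomial σ k) := fun s => by
    simp [aug, constantCoeff_eq]
  let gr (d : ℕ) (s : S) : S := ⟨homogeneousComponent d (s : MvPolynomial σ k), hS s s.2 d⟩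
  let pr (d : ℕ) : P →ₗ[k] P :=
    { toFun := fun p => ⟨homogeneousComponent d (p : MvPolynomial σ k), hP p p.2 d⟩
      map_add' := fun p q => Subtype.ext (map_add _ _ _)
      map_smul' := fun c p => Subtype.ext (map_smul (homogeneousComponent d) c _) }
  have hgr : ∀ s, aug s = 0 → gr 0 s = 0 := by
    intro s hs
    apply Subtype.ext
    rw [haug] at hs
    simp [gr, homogeneousComponent_zero, hs]
  have hmul : ∀ d s p, pr d (s • p) =
      ∑ ij ∈ Finset.HasAntidiagonal.antidiagonal d, gr ij.1 s • pr ij.2 p := by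
    intro d s p
    apply Subtype.ext
    rw [AddSubmonoidClass.coe_finsetSum]
    exact homogeneousComponent_mul d (s : MvPolynomial σ k) (p : MvPolynomial σ k)
  have hsum : ∀ p, ∃ n, p = ∑ d ∈ Finset.range n, pr d p := by
    intro p
    refine ⟨(p : MvPolynomial σ k).totalDegree + 1, Subtype.ext ?_⟩
    rw [AddSubmonoidClass.coe_finsetSum]
    exact (sum_homogeneousComponent (p : MvPolynomial σ k)).symm
  have hpr : ∀ d e p, pr d (pr e p) = if e = d then pr e p else 0 := by
    intro d e p
    apply Subtype.ext
    rw [apply_ite (Subtype.val : P → MvPolynomial σ k)]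
    exact homogeneousComponent_homogeneousComponent d e _
  have hdom : IsDomain S := inferInstance
  have htower : IsScalarTower k S P := inferInstance
  have hex := exists_basis_of_graded (k := k) (S := S) (P := P) aug gr pr hgr hmul hsum hpr
  obtain ⟨n, b, hli, hspan⟩ := hex
  refine ⟨n, fun i => b i, hli.map' P.subtype P.ker_subtype, ?_⟩
  have h := congrArg (Submodule.map P.subtype) hspan
  rwa [Submodule.map_span, ← Set.range_comp, Submodule.map_subtype_top] at h

section

variable {X Y : Type*} [Fintype X]

theorem homogeneousComponent_mem_leftSymm {p : MvPolynomial (X ⊕ Y) ℚ} (hp : p ∈ leftSymm X Y)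
    (d : ℕ) : homogeneousComponent d p ∈ leftSymm X Y := by
  refine homogeneousComponent_mem_adjoin ?_ hp d
  rintro _ ⟨r, -, -, rfl⟩
  refine ⟨r, IsHomogeneous.rename_isHomogeneous ?_⟩
  refine IsHomogeneous.sum _ _ _ fun t ht => ?_
  have h := IsHomogeneous.prod t (fun i => (MvPolynomial.X i : MvPolynomial X ℚ)) (fun _ => 1)
    fun i _ => isHomogeneous_X ℚ i
  rwa [Finset.sum_const, (Finset.mem_powersetCard.mp ht).2, smul_eq_mul, mul_one] at h

theorem rename_eq_of_mem_leftSymm (e : Equiv.Perm (X ⊕ Y))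
    (he : ∀ x : X, ∃ x', e (Sum.inl x) = Sum.inl x') {p : MvPolynomial (X ⊕ Y) ℚ}
    (hp : p ∈ leftSymm X Y) : rename e p = p :=
  rename_eq_of_mem_leftSymmAdjoin (T := ∅) e he (by simp) (by rwa [leftSymmAdjoin_empty])

theorem apply_inr_eq_zero_of_mem_leftSymm {p : MvPolynomial (X ⊕ Y) ℚ} (hp : p ∈ leftSymm X Y)
    {m : X ⊕ Y →₀ ℕ} (hm : m ∈ p.support) (y : Y) : m (Sum.inr y) = 0 := by
  classical
  have hle : leftSymm X Y ≤
      (rename Sum.inl : MvPolynomial X ℚ →ₐ[ℚ] MvPolynomial (X ⊕ Y) ℚ).range := by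
    rw [← leftSymmAdjoin_univ, ← leftSymmAdjoin_empty]
    exact leftSymmAdjoin_mono (Finset.empty_subset _)
  obtain ⟨q, rfl⟩ := hle hp
  rw [AlgHom.toRingHom_eq_coe, RingHom.coe_coe,
    support_rename_of_injective Sum.inl_injective] at hm
  obtain ⟨u, -, rfl⟩ := Finset.mem_image.mp hm
  exact Finsupp.mapDomain_of_notMem_range _ _ (by simp)

variable (X Y) in
/-- The polynomials all of whose monomials are squarefree in the right variables. -/
noncomputable def rightSquarefree : Submodule (leftSymm X Y) (MvPolynomial (X ⊕ Y) ℚ) where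
  carrier := {p | ∀ m ∈ p.support, ∀ y, m (Sum.inr y) ≤ 1}
  zero_mem' := by simp
  add_mem' := by
    classical
    intro p q hp hq m hm y
    rcases Finset.mem_union.mp (support_add hm) with h | h
    · exact hp m h y
    · exact hq m h y
  smul_mem' := by
    classical
    intro s p hp m hm y
    obtain ⟨a, ha, b, hb, rfl⟩ := Finset.mem_add.mp (support_mul (s : MvPolynomial (X ⊕ Y) ℚ) p hm)
    simpa [apply_inr_eq_zero_of_mem_leftSymm s.2 ha y] using hp b hb y

theorem homogeneousComponent_mem_rightSquarefree {p : MvPolynomial (X ⊕ Y) ℚ}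
    (hp : p ∈ rightSquarefree X Y) (d : ℕ) : homogeneousComponent d p ∈ rightSquarefree X Y := by
  intro m hm
  rw [support_homogeneousComponent] at hm
  exact hp m (Finset.mem_filter.mp hm).1

theorem rename_mem_rightSquarefree (e : Equiv.Perm (X ⊕ Y))
    (he : ∀ y : Y, ∃ y', e.symm (Sum.inr y) = Sum.inr y') {p : MvPolynomial (X ⊕ Y) ℚ}
    (hp : p ∈ rightSquarefree X Y) : rename e p ∈ rightSquarefree X Y := by
  classical
  intro m hm y
  rw [support_rename_of_injective e.injective] at hm
  obtain ⟨u, hu, rfl⟩ := Finset.mem_image.mp hm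
  obtain ⟨y', hy'⟩ := he y
  rw [← e.apply_symm_apply (Sum.inr y), hy', Finsupp.mapDomain_apply e.injective]
  exact hp u hu y'

variable (X Y) in
/-- The ideal generated by the squares of the right variables. -/
noncomputable def rightSquares : Ideal (MvPolynomial (X ⊕ Y) ℚ) :=
  Ideal.span {q | ∃ y : Y, q = (MvPolynomial.X (Sum.inr y) : MvPolynomial (X ⊕ Y) ℚ) ^ 2}

omit [Fintype X] in
theorem mem_rightSquares {p : MvPolynomial (X ⊕ Y) ℚ} :
    p ∈ rightSquares X Y ↔ ∀ m ∈ p.support, ∃ y, 2 ≤ m (Sum.inr y) := by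
  have : {q | ∃ y : Y, q = (MvPolynomial.X (Sum.inr y) : MvPolynomial (X ⊕ Y) ℚ) ^ 2} =
      (fun s => monomial s (1 : ℚ)) '' Set.range fun y : Y => Finsupp.single (Sum.inr y) 2 := by
    ext q
    simp [X_pow_eq_monomial, eq_comm]
  rw [rightSquares, this, mem_ideal_span_monomial_image]
  simp

omit [Fintype X] in
theorem rename_mem_rightSquares (e : Equiv.Perm (X ⊕ Y))
    (he : ∀ y : Y, ∃ y', e (Sum.inr y) = Sum.inr y') {p : MvPolynomial (X ⊕ Y) ℚ}
    (hp : p ∈ rightSquares X Y) : rename e p ∈ rightSquares X Y := by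
  have hle : rightSquares X Y ≤ (rightSquares X Y).comap (rename e : _ →ₐ[ℚ] _) := by
    refine Ideal.span_le.mpr ?_
    rintro _ ⟨y, rfl⟩
    obtain ⟨y', hy'⟩ := he y
    exact Ideal.subset_span ⟨y', by simp [hy']⟩
  exact hle hp

theorem isCompl_rightSquares_rightSquarefree :
    IsCompl ((rightSquares X Y).restrictScalars (leftSymm X Y)) (rightSquarefree X Y) := by
  constructor
  · rw [Submodule.disjoint_def]
    intro p hJ hp
    rw [Submodule.restrictScalars_mem, mem_rightSquares] at hJ
    rw [← support_eq_empty, Finset.eq_empty_iff_forall_notMem]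
    intro m hm
    obtain ⟨y, hy⟩ := hJ m hm
    have := hp m hm y
    omega
  · rw [codisjoint_iff, eq_top_iff]
    rintro p -
    rw [p.as_sum]
    refine sum_mem fun m _ => ?_
    by_cases hm : ∃ y, 2 ≤ m (Sum.inr y)
    · refine Submodule.mem_sup_left ?_
      rw [Submodule.restrictScalars_mem, mem_rightSquares]
      intro u hu
      rwa [Finset.mem_singleton.mp (support_monomial_subset hu)]
    · refine Submodule.mem_sup_right fun u hu y => ?_
      rw [Finset.mem_singleton.mp (support_monomial_subset hu)]
      by_contra h
      exact hm ⟨y, by omega⟩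

theorem projective_rightSquarefree : Module.Projective (leftSymm X Y) (rightSquarefree X Y) := by
  have := free_leftSymm (X := X) (Y := Y)
  have hc := (isCompl_rightSquares_rightSquarefree (X := X) (Y := Y)).symm
  refine Module.Projective.of_split (rightSquarefree X Y).subtype
    (Submodule.projectionOnto _ _ hc) ?_
  ext1 p
  exact Submodule.projectionOnto_apply_left hc p

theorem isIntegral_X_inl (x : X) :
    IsIntegral (leftSymm X Y) (MvPolynomial.X (Sum.inl x) : MvPolynomial (X ⊕ Y) ℚ) := by
  classical
  have h := prod_X_sub_C_mem_lifts (X := X) (Y := Y) ∅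
  rw [leftSymmAdjoin_empty, Finset.compl_empty] at h
  obtain ⟨f, hf, -, hfm⟩ := Polynomial.lifts_and_degree_eq_and_monic h
    (Polynomial.monic_prod_of_monic _ _ fun x _ => Polynomial.monic_X_sub_C _)
  refine ⟨f, hfm, ?_⟩
  rw [← Polynomial.eval_map, hf, Polynomial.eval_prod]
  exact Finset.prod_eq_zero (Finset.mem_univ x) (by simp)

theorem finite_quotient_rightSquares [Finite Y] :
    Module.Finite (leftSymm X Y) (MvPolynomial (X ⊕ Y) ℚ ⧸ rightSquares X Y) := by
  have hft : Algebra.FiniteType (leftSymm X Y) (MvPolynomial (X ⊕ Y) ℚ ⧸ rightSquares X Y) :=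
    Algebra.FiniteType.of_restrictScalars_finiteType ℚ _ _
  have hint : Algebra.IsIntegral (leftSymm X Y)
      (MvPolynomial (X ⊕ Y) ℚ ⧸ rightSquares X Y) := by
    refine ⟨fun q => ?_⟩
    obtain ⟨p, rfl⟩ := Ideal.Quotient.mk_surjective q
    induction p using MvPolynomial.induction_on with
    | C a => exact isIntegral_algebraMap (x := algebraMap ℚ (leftSymm X Y) a)
    | add p q hp hq => rw [map_add]; exact hp.add hq
    | mul_X p i hp =>
      rw [map_mul]
      refine hp.mul ?_
      rcases i with x | y
      · exact (isIntegral_X_inl x).map (Ideal.Quotient.mkₐ (leftSymm X Y) (rightSquares X Y))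
      · refine IsIntegral.of_pow (n := 2) two_pos ?_
        have hy : (MvPolynomial.X (Sum.inr y) : MvPolynomial (X ⊕ Y) ℚ) ^ 2 ∈ rightSquares X Y :=
          Ideal.subset_span ⟨y, rfl⟩
        rw [← map_pow, Ideal.Quotient.eq_zero_iff_mem.mpr hy]
        exact isIntegral_zero
  exact Algebra.IsIntegral.finite

theorem finite_rightSquarefree [Finite Y] :
    Module.Finite (leftSymm X Y) (rightSquarefree X Y) := by
  have := finite_quotient_rightSquares (X := X) (Y := Y)
  exact Module.Finite.equiv
    ((Submodule.Quotient.restrictScalarsEquiv (leftSymm X Y) (rightSquares X Y)).symm.trans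
      (Submodule.quotientEquivOfIsCompl _ _ isCompl_rightSquares_rightSquarefree))

variable {F : Type*} [Group F] (ρ : F →* Equiv.Perm (X ⊕ Y))
  (hstab : ∀ f : F, (∀ x : X, ∃ x', ρ f (Sum.inl x) = Sum.inl x') ∧
    (∀ y : Y, ∃ y', ρ f (Sum.inr y) = Sum.inr y'))

include hstab in
theorem rename_smul_leftSymm (f : F) (s : leftSymm X Y) (p : MvPolynomial (X ⊕ Y) ℚ) :
    rename (ρ f) (s • p) = s • rename (ρ f) p := by
  change rename (ρ f) ((s : MvPolynomial (X ⊕ Y) ℚ) * p) = s * rename (ρ f) p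
  rw [map_mul, rename_eq_of_mem_leftSymm _ (hstab f).1 s.2]

/-- The invariant polynomials which are squarefree in the right variables. -/
noncomputable def invariantSquarefree : Submodule (leftSymm X Y) (MvPolynomial (X ⊕ Y) ℚ) where
  carrier := {p | p ∈ rightSquarefree X Y ∧ p ∈ invariantAlg F ρ}
  zero_mem' := ⟨zero_mem _, zero_mem _⟩
  add_mem' hp hq := ⟨add_mem hp.1 hq.1, add_mem hp.2 hq.2⟩
  smul_mem' s p hp := ⟨Submodule.smul_mem _ s hp.1, fun f => by
    rw [rename_smul_leftSymm ρ hstab, hp.2 f]⟩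

/-- The average of a polynomial over the group `F`. -/
noncomputable def reynolds [Fintype F] (p : MvPolynomial (X ⊕ Y) ℚ) : MvPolynomial (X ⊕ Y) ℚ :=
  (Fintype.card F : ℚ)⁻¹ • ∑ f : F, rename (ρ f) p

omit [Fintype X] in
theorem reynolds_mem_invariantAlg [Fintype F] (p : MvPolynomial (X ⊕ Y) ℚ) :
    reynolds ρ p ∈ invariantAlg F ρ := by
  intro g
  rw [reynolds, map_smul, map_sum]
  congr 1
  refine Fintype.sum_equiv (Equiv.mulLeft g) _ _ fun f => ?_
  rw [rename_rename, Equiv.coe_mulLeft, map_mul, Equiv.Perm.coe_mul]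

omit [Fintype X] in
theorem reynolds_eq_self [Fintype F] {p : MvPolynomial (X ⊕ Y) ℚ} (hp : p ∈ invariantAlg F ρ) :
    reynolds ρ p = p := by
  have hp' : ∀ f : F, rename (ρ f) p = p := hp
  simp only [reynolds, hp', Finset.sum_const, Finset.card_univ]
  rw [← Nat.cast_smul_eq_nsmul ℚ, smul_smul, inv_mul_cancel₀ (by simp), one_smul]

include hstab in
theorem reynolds_mem_rightSquarefree [Fintype F] {p : MvPolynomial (X ⊕ Y) ℚ}
    (hp : p ∈ rightSquarefree X Y) : reynolds ρ p ∈ rightSquarefree X Y := by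
  rw [reynolds, ← algebraMap_smul (leftSymm X Y)]
  refine Submodule.smul_mem _ _ (sum_mem fun f _ => rename_mem_rightSquarefree _ ?_ hp)
  intro y
  obtain ⟨y', hy'⟩ := (hstab f⁻¹).2 y
  exact ⟨y', by rw [← hy', map_inv]; rfl⟩

/-- The projection of the polynomials squarefree in the right variables onto the invariant ones. -/
noncomputable def reynoldsSquarefree [Fintype F] :
    rightSquarefree X Y →ₗ[leftSymm X Y] invariantSquarefree ρ hstab where
  toFun p := ⟨reynolds ρ p, reynolds_mem_rightSquarefree ρ hstab p.2,
    reynolds_mem_invariantAlg ρ _⟩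
  map_add' p q := Subtype.ext <| by
    simp [reynolds, Finset.sum_add_distrib]
  map_smul' s p := Subtype.ext <| by
    simp only [reynolds, Submodule.coe_smul, rename_smul_leftSymm ρ hstab, RingHom.id_apply,
      ← Finset.smul_sum]
    rw [smul_comm]

theorem exists_basis_invariantSquarefree [Finite Y] [Finite F] :
    ∃ (n : ℕ) (b : Fin n → MvPolynomial (X ⊕ Y) ℚ), LinearIndependent (leftSymm X Y) b ∧
      Submodule.span (leftSymm X Y) (Set.range b) = invariantSquarefree ρ hstab := by
  have := Fintype.ofFinite F
  have := projective_rightSquarefree (X := X) (Y := Y)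
  have := finite_rightSquarefree (X := X) (Y := Y)
  let i : invariantSquarefree ρ hstab →ₗ[leftSymm X Y] rightSquarefree X Y :=
    Submodule.inclusion fun p hp => hp.1
  have hi : ∀ p, reynoldsSquarefree ρ hstab (i p) = p := fun p =>
    Subtype.ext (reynolds_eq_self ρ p.2.2)
  have : Module.Projective (leftSymm X Y) (invariantSquarefree ρ hstab) :=
    Module.Projective.of_split i (reynoldsSquarefree ρ hstab) (LinearMap.ext hi)
  have : Module.Finite (leftSymm X Y) (invariantSquarefree ρ hstab) :=
    Module.Finite.of_surjective (reynoldsSquarefree ρ hstab) fun p => ⟨i p, hi p⟩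
  refine exists_basis_of_homogeneousComponent_mem _ _
    (fun s hs d => homogeneousComponent_mem_leftSymm hs d) fun p hp d =>
    ⟨homogeneousComponent_mem_rightSquarefree hp.1 d, fun f => ?_⟩
  rw [rename_homogeneousComponent, hp.2 f]

/-- Every invariant polynomial is congruent modulo the squares of the right variables to an
invariant polynomial which is squarefree in the right variables. -/
theorem exists_invariantSquarefree_sub_mem {p : MvPolynomial (X ⊕ Y) ℚ}
    (hp : p ∈ invariantAlg F ρ) :
    ∃ q ∈ invariantSquarefree ρ hstab, p - q ∈ rightSquares X Y := by
  have hc := isCompl_rightSquares_rightSquarefree (X := X) (Y := Y)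
  obtain ⟨j, hj, q, hq, rfl⟩ := Submodule.mem_sup.mp (hc.sup_eq_top ▸ Submodule.mem_top (x := p))
  rw [Submodule.restrictScalars_mem] at hj
  refine ⟨q, ⟨hq, fun f => ?_⟩, by simpa using hj⟩
  have hf := hp f
  rw [map_add] at hf
  have hrq : rename (ρ f) q ∈ rightSquarefree X Y := by
    refine rename_mem_rightSquarefree _ (fun y => ?_) hq
    obtain ⟨y', hy'⟩ := (hstab f⁻¹).2 y
    exact ⟨y', by rw [← hy', map_inv]; rfl⟩
  rw [← sub_eq_zero]
  refine Submodule.disjoint_def.mp hc.disjoint _ ?_ (sub_mem hrq hq)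
  rw [Submodule.restrictScalars_mem, show rename (ρ f) q - q = j - rename (ρ f) j by
    linear_combination hf]
  exact sub_mem hj (rename_mem_rightSquares _ (hstab f).2 hj)

theorem eq_of_mk_eq_mk {p q : MvPolynomial (X ⊕ Y) ℚ} (hp : p ∈ rightSquarefree X Y)
    (hq : q ∈ rightSquarefree X Y)
    (h : Ideal.Quotient.mk (rightSquares X Y) p = Ideal.Quotient.mk (rightSquares X Y) q) :
    p = q :=
  sub_eq_zero.mp (Submodule.disjoint_def.mp isCompl_rightSquares_rightSquarefree.disjoint _
    (Ideal.Quotient.eq.mp h) (sub_mem hp hq))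

end

/-- Let `F` be a finite group permuting the variables of
`R = MvPolynomial (X ⊕ Y) ℚ` while stabilizing the `X`-variables and the
`Y`-variables, `A` the invariant subalgebra, `J` the ideal generated by the
squares of the `Y`-variables, and `Q` the image of `A` in `R ⧸ J`. Then `Q`
is free and finitely generated as a module over the subalgebra `S` generated
by (the images of) the elementary symmetric polynomials `e_1, …, e_{|X|}` in
the `X`-variables: there is a finite family of elements of `Q` such that every
element of `Q` is, in a unique way, an `S`-linear combination of them. -/
theorem invariants_mod_squares_cohenMacaulay
    (X Y : Type*) [Fintype X] [Fintype Y]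
    (F : Type*) [Group F] [Finite F] (ρ : F →* Equiv.Perm (X ⊕ Y))
    (hstab : ∀ f : F, (∀ x : X, ∃ x', ρ f (Sum.inl x) = Sum.inl x') ∧
      (∀ y : Y, ∃ y', ρ f (Sum.inr y) = Sum.inr y'))
    (J : Ideal (MvPolynomial (X ⊕ Y) ℚ))
    (hJ : J = Ideal.span {q | ∃ y : Y, q = (MvPolynomial.X (Sum.inr y) : MvPolynomial (X ⊕ Y) ℚ) ^ 2})
    (Q S : Subalgebra ℚ (MvPolynomial (X ⊕ Y) ℚ ⧸ J))
    (hQ : Q = (invariantAlg F ρ).map (Ideal.Quotient.mkₐ ℚ J))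
    (hS : S = Algebra.adjoin ℚ
      ((fun p => Ideal.Quotient.mkₐ ℚ J p) ''
        {p | ∃ r : ℕ, 1 ≤ r ∧ r ≤ Fintype.card X ∧
          p = rename Sum.inl (esymm X ℚ r)})) :
    ∃ (n : ℕ) (bv : Fin n → MvPolynomial (X ⊕ Y) ℚ ⧸ J),
      (∀ i, bv i ∈ Q) ∧
      ∀ q ∈ Q, ∃! c : Fin n → S, q = ∑ i, (c i : MvPolynomial (X ⊕ Y) ℚ ⧸ J) * bv i := by
  obtain rfl : J = rightSquares X Y := hJ
  have hmapS : S = (leftSymm X Y).map (Ideal.Quotient.mkₐ ℚ (rightSquares X Y)) := by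
    rw [hS, leftSymm, AlgHom.map_adjoin]
    rfl
  subst hQ hmapS
  clear hS
  obtain ⟨n, b, hli, hspan⟩ := exists_basis_invariantSquarefree ρ hstab
  have hmem : ∀ s : Fin n → leftSymm X Y, ∑ i, s i • b i ∈ rightSquarefree X Y := fun s => by
    have h : ∑ i, s i • b i ∈ invariantSquarefree ρ hstab :=
      hspan ▸ sum_mem fun i _ => Submodule.smul_mem _ _ (Submodule.subset_span ⟨i, rfl⟩)
    exact h.1
  have hmk : ∀ s : Fin n → leftSymm X Y, Ideal.Quotient.mk (rightSquares X Y) (∑ i, s i • b i) =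
      ∑ i, Ideal.Quotient.mk (rightSquares X Y) (s i) *
        Ideal.Quotient.mk (rightSquares X Y) (b i) := fun s => by
    rw [map_sum]
    exact Finset.sum_congr rfl fun i _ => map_mul _ _ _
  refine ⟨n, fun i => Ideal.Quotient.mk _ (b i), fun i => ⟨b i, ?_, rfl⟩, ?_⟩
  · have h : b i ∈ invariantSquarefree ρ hstab := hspan ▸ Submodule.subset_span ⟨i, rfl⟩
    exact h.2
  rintro _ ⟨p, hp, rfl⟩
  obtain ⟨q, hq, hpq⟩ := exists_invariantSquarefree_sub_mem ρ hstab hp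
  rw [← hspan] at hq
  obtain ⟨s, rfl⟩ := (Submodule.mem_span_range_iff_exists_fun (leftSymm X Y)).mp hq
  have hsq := (Ideal.Quotient.eq.mpr hpq).trans (hmk s)
  refine ⟨fun i => ⟨Ideal.Quotient.mk _ (s i : MvPolynomial (X ⊕ Y) ℚ), _, (s i).2, rfl⟩, hsq, ?_⟩
  intro c hc
  choose t ht htc using fun i => (c i).2
  let u : Fin n → leftSymm X Y := fun i => ⟨t i, ht i⟩
  have huc : ∀ i, Ideal.Quotient.mk (rightSquares X Y) (u i) = c i := htc
  have heq : ∑ i, s i • b i = ∑ i, u i • b i := by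
    refine eq_of_mk_eq_mk (hmem s) (hmem u) ?_
    rw [hmk, hmk, ← hsq]
    simp only [huc]
    exact hc
  have hsu : ∀ i, s i = u i := fun i => by
    have h := Fintype.linearIndependent_iff.mp hli (fun i => s i - u i) (by
      simp only [sub_smul, Finset.sum_sub_distrib, heq, sub_self])
    exact sub_eq_zero.mp (h i)
  refine funext fun i => Subtype.ext ?_
  rw [← huc, ← hsu]
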